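/- Uniform convergence of aggregate (majority-vote) regression. Let X'₁,…,X'_I be independent subsamples of the sample (X,Y), and define η̂♯_i(x) = η̂(NN(X'_i;x)). Suppose there exists φ = φ(n,m) such that max_{i∈[I]} P(∃x∈𝒳: ‖η̂♯_i(x) − η(x)‖_∞ > φ) ≤ δ for some 0<δ<1, where the probability is over (X,Y,X'_i). Let h̄ be the subNN estimate (majority vote of the denoised 1-NN classifiers ĥ_i(x)=argmax_l η̂♯_{i,l}(x)). Then, with probability at least 1−Lδ over (X,Y) and {X'_i}_{i=1}^I, simultaneously for all x∈𝒳: η_{h*(x)}(x) − η_{h̄(x)}(x) ≤ 2φ. -/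

import Mathlib

open MeasureTheory Finset Metric

noncomputable section

/-- Subsets of a finite index set carry the discrete σ-algebra. -/
instance finsetMeasurableSpace {β : Type*} : MeasurableSpace (Finset β) := ⊤

/-- `kNNI Xs x` is a set of indices of the `k` nearest neighbors of `x` in the
sample `Xs` (ties broken so that it has exactly `k` elements). -/
def IsKNNIndex {D n : ℕ} (k : ℕ)
    (kNNI : (Fin n → EuclideanSpace ℝ (Fin D)) → EuclideanSpace ℝ (Fin D) → Finset (Fin n)) :
    Prop :=
  ∀ Xs x, (kNNI Xs x).card = k ∧
    ∀ i ∈ kNNI Xs x, ∀ j ∉ kNNI Xs x, dist x (Xs i) ≤ dist x (Xs j)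

/-- `nnS Xs S x` is (an index of) the nearest neighbor of `x` among the subsample
of `Xs` indexed by the nonempty index set `S`. -/
def IsSubNN {D n : ℕ}
    (nnS : (Fin n → EuclideanSpace ℝ (Fin D)) → Finset (Fin n) →
      EuclideanSpace ℝ (Fin D) → Fin n) : Prop :=
  ∀ (Xs : Fin n → EuclideanSpace ℝ (Fin D)) (S : Finset (Fin n))
    (x : EuclideanSpace ℝ (Fin D)), S.Nonempty →
    nnS Xs S x ∈ S ∧ ∀ j ∈ S, dist x (Xs (nnS Xs S x)) ≤ dist x (Xs j)

/-- The denoised 1-NN regression estimate `η̂♯(x) = η̂(NN(X';x))`: the k-NN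
regression estimate of the labeled sample `s`, evaluated at the nearest neighbor
of `x` among the subsample of `s` indexed by `S`. -/
def denoisedEst {D L n : ℕ} (k : ℕ)
    (kNNI : (Fin n → EuclideanSpace ℝ (Fin D)) → EuclideanSpace ℝ (Fin D) → Finset (Fin n))
    (nnS : (Fin n → EuclideanSpace ℝ (Fin D)) → Finset (Fin n) →
      EuclideanSpace ℝ (Fin D) → Fin n)
    (s : Fin n → EuclideanSpace ℝ (Fin D) × Fin L) (S : Finset (Fin n))
    (x : EuclideanSpace ℝ (Fin D)) (l : Fin L) : ℝ :=
  (1 / (k : ℝ)) * ∑ i ∈ kNNI (fun j => (s j).1) ((fun j => (s j).1) (nnS (fun j => (s j).1) S x)),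
    if (s i).2 = l then (1 : ℝ) else 0

/-- Uniform convergence of aggregate (majority-vote) regression.
If each of the `I` denoised 1-NN regression estimates `η̂♯_i` satisfies
`P(∃x∈𝒳 : ‖η̂♯_i(x) − η(x)‖_∞ > φ) ≤ δ`, then with probability at least `1 − Lδ`
over the sample and the `I` independent subsamples, simultaneously for all
`x ∈ 𝒳`, the majority-vote classifier `h̄` satisfies
`η_{h*(x)}(x) − η_{h̄(x)}(x) ≤ 2φ`. -/
theorem uniform_aggregate_regression
    (D L n m k I : ℕ) (hL : 0 < L) (hI : 0 < I) (hm : 0 < m) (hmn : m ≤ n)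
    (hk : 0 < k) (hkn : k ≤ n)
    (𝒳 : Set (EuclideanSpace ℝ (Fin D)))
    (P : Measure (EuclideanSpace ℝ (Fin D) × Fin L)) [IsProbabilityMeasure P]
    (hsupp : P {p | p.1 ∈ 𝒳} = 1)
    (η : EuclideanSpace ℝ (Fin D) → Fin L → ℝ)
    (hη : ∀ x l, η x l ∈ Set.Icc (0 : ℝ) 1)
    -- the Bayes classifier h*, an argmax of η
    (hstar : EuclideanSpace ℝ (Fin D) → Fin L)
    (hstar_max : ∀ x l, η x l ≤ η x (hstar x))
    -- nearest-neighbor structure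
    (kNNI : (Fin n → EuclideanSpace ℝ (Fin D)) → EuclideanSpace ℝ (Fin D) → Finset (Fin n))
    (hkNNI : IsKNNIndex k kNNI)
    (nnS : (Fin n → EuclideanSpace ℝ (Fin D)) → Finset (Fin n) →
      EuclideanSpace ℝ (Fin D) → Fin n)
    (hnnS : IsSubNN nnS)
    -- the argmax selector defining the denoised 1-NN classifiers ĥ_i
    (amax : (Fin L → ℝ) → Fin L)
    (hamax : ∀ (v : Fin L → ℝ) (l : Fin L), v l ≤ v (amax v))
    -- the majority-vote (plurality) selector
    (maj : (Fin I → Fin L) → Fin L)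
    (hmaj : ∀ (v : Fin I → Fin L) (l' : Fin L),
      (Finset.univ.filter fun i => v i = l').card
        ≤ (Finset.univ.filter fun i => v i = maj v).card)
    -- the distributions of the I independent subsamples (index sets of size m,
    -- drawn uniformly without replacement, independently of the sample)
    (Qi : Fin I → Measure (Finset (Fin n))) (hQprob : ∀ i, IsProbabilityMeasure (Qi i))
    (hQunif : ∀ (i : Fin I) (S : Finset (Fin n)),
      Qi i {S} = if S.card = m then ((n.choose m : ENNReal))⁻¹ else 0)
    (φ δ : ℝ) (hφ : 0 ≤ φ) (hδ0 : 0 < δ) (hδ1 : δ < 1)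
    -- hypothesis: each denoised estimate has uniform error ≤ φ except w.p. ≤ δ
    (herr : ∀ i : Fin I,
      (((Measure.pi fun _ : Fin n => P).prod (Qi i))
        {p | ∃ x ∈ 𝒳, ∃ l : Fin L,
          φ < |denoisedEst k kNNI nnS p.1 p.2 x l - η x l|}).toReal ≤ δ) :
    1 - L * δ ≤ (((Measure.pi fun _ : Fin n => P).prod (Measure.pi fun i : Fin I => Qi i))
      {p | ∀ x ∈ 𝒳,
        η x (hstar x)
          - η x (maj fun i => amax fun l => denoisedEst k kNNI nnS p.1 (p.2 i) x l)
          ≤ 2 * φ}).toReal := by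
  classical
  haveI := hQprob
  set μ := Measure.pi fun _ : Fin n => P with hμ
  set ν := Measure.pi fun i : Fin I => Qi i with hν
  set B : Fin I → Set ((Fin n → EuclideanSpace ℝ (Fin D) × Fin L) × Finset (Fin n)) :=
    fun i => {p | ∃ x ∈ 𝒳, ∃ l : Fin L,
          φ < |denoisedEst k kNNI nnS p.1 p.2 x l - η x l|} with hB
  set T := fun i => toMeasurable (μ.prod (Qi i)) (B i) with hT
  have hTm : ∀ i, MeasurableSet (T i) := fun i => measurableSet_toMeasurable _ _
  have hTμ : ∀ i, (μ.prod (Qi i)) (T i) ≤ ENNReal.ofReal δ := by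
    intro i
    rw [hT]
    simp only
    rw [measure_toMeasurable]
    rw [← ENNReal.ofReal_toReal (measure_ne_top (μ.prod (Qi i)) (B i))]
    exact ENNReal.ofReal_le_ofReal (herr i)
  set g : Fin I → ((Fin n → EuclideanSpace ℝ (Fin D) × Fin L) × (Fin I → Finset (Fin n))) →
    ((Fin n → EuclideanSpace ℝ (Fin D) × Fin L) × Finset (Fin n)) :=
    fun i => Prod.map id (Function.eval i) with hg
  have hgp : ∀ i, MeasurePreserving (g i) (μ.prod ν) (μ.prod (Qi i)) := fun i =>
    (MeasurePreserving.id μ).prod (measurePreserving_eval Qi i)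
  have hT'm : ∀ i, MeasurableSet (g i ⁻¹' T i) := fun i => (hgp i).measurable (hTm i)
  have hT'μ : ∀ i, (μ.prod ν) (g i ⁻¹' T i) ≤ ENNReal.ofReal δ := fun i => by
    rw [(hgp i).measure_preimage (hTm i).nullMeasurableSet]
    exact hTμ i
  set f : ((Fin n → EuclideanSpace ℝ (Fin D) × Fin L) × (Fin I → Finset (Fin n))) → ENNReal :=
    fun p => L * ∑ i, (g i ⁻¹' T i).indicator (fun _ => (1 : ENNReal)) p with hf
  have hfm0 : Measurable fun p : ((Fin n → EuclideanSpace ℝ (Fin D) × Fin L) × (Fin I → Finset (Fin n))) =>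
      ∑ i, (g i ⁻¹' T i).indicator (fun _ => (1 : ENNReal)) p :=
    Finset.measurable_sum _ fun i _ => measurable_const.indicator (hT'm i)
  have hfm : Measurable f := hfm0.const_mul _
  have hint : ∫⁻ p, f p ∂(μ.prod ν) ≤ I * (L * ENNReal.ofReal δ) := by
    rw [hf, lintegral_const_mul _ hfm0,
      lintegral_finsetSum _ fun i _ => measurable_const.indicator (hT'm i)]
    calc _ ≤ (L : ENNReal) * ∑ i : Fin I, ENNReal.ofReal δ := by
            gcongr with i
            rw [lintegral_indicator_const (hT'm i), one_mul]
            exact hT'μ i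
      _ = _ := by simp; ring
  set M := {p | (I : ENNReal) ≤ f p} with hM
  have hMm : MeasurableSet M := measurableSet_le measurable_const hfm
  have hMμ : (μ.prod ν) M ≤ L * ENNReal.ofReal δ := by
    have h := (mul_meas_ge_le_lintegral (μ := μ.prod ν) hfm (I : ENNReal)).trans hint
    exact (ENNReal.mul_le_mul_iff_right (by exact_mod_cast hI.ne') (ENNReal.natCast_ne_top I)).1 h
  have hMr : (μ.prod ν).real M ≤ L * δ := by
    have := ENNReal.toReal_mono (ENNReal.mul_ne_top (ENNReal.natCast_ne_top L)
      ENNReal.ofReal_ne_top) hMμ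
    simpa [ENNReal.toReal_mul, ENNReal.toReal_ofReal hδ0.le, Measure.real] using this
  have hsub : Mᶜ ⊆ {p | ∀ x ∈ 𝒳,
        η x (hstar x)
          - η x (maj fun i => amax fun l => denoisedEst k kNNI nnS p.1 (p.2 i) x l)
          ≤ 2 * φ} := by
    intro p hp x hx
    by_contra hbad
    push Not at hbad
    apply hp
    set v : Fin I → Fin L := fun i => amax fun l => denoisedEst k kNNI nnS p.1 (p.2 i) x l with hv
    have hcard : I ≤ L * (Finset.univ.filter fun i => v i = maj v).card := by
      have h1 := Finset.card_eq_sum_card_fiberwise (f := v) (s := Finset.univ) (t := Finset.univ)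
        (fun _ _ => by simp)
      have h2 := Finset.sum_le_card_nsmul Finset.univ
        (fun l' => (Finset.univ.filter fun i => v i = l').card) _ (fun l' _ => hmaj v l')
      simp only [Finset.card_univ, Fintype.card_fin, smul_eq_mul] at h1 h2
      omega
    have hmem : ∀ i, v i = maj v → p ∈ g i ⁻¹' T i := by
      intro i hi
      apply subset_toMeasurable
      by_contra hgood
      have hgood' : ∀ l, |denoisedEst k kNNI nnS p.1 (p.2 i) x l - η x l| ≤ φ := by
        intro l
        by_contra hl
        exact hgood ⟨x, hx, l, not_le.1 hl⟩
      have a := abs_le.1 (hgood' (hstar x))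
      have b := abs_le.1 (hgood' (maj v))
      have c := hamax (fun l => denoisedEst k kNNI nnS p.1 (p.2 i) x l) (hstar x)
      have hi' : amax (fun l => denoisedEst k kNNI nnS p.1 (p.2 i) x l) = maj v := hi
      rw [hi'] at c
      linarith [a.1, b.2]
    have hle : (((Finset.univ.filter fun i => v i = maj v).card : ℕ) : ENNReal)
        ≤ ∑ i, (g i ⁻¹' T i).indicator (fun _ => (1 : ENNReal)) p := by
      rw [Finset.card_filter]
      push_cast
      apply Finset.sum_le_sum
      intro i _
      split_ifs with h
      · rw [Set.indicator_of_mem (hmem i h)]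
      · exact zero_le
    show (I : ENNReal) ≤ L * _
    calc (I : ENNReal) ≤ ((L * (Finset.univ.filter fun i => v i = maj v).card : ℕ) : ENNReal) := by
          exact_mod_cast hcard
      _ ≤ _ := by push_cast; gcongr
  have hc := measureReal_mono (μ := μ.prod ν) hsub
  rw [probReal_compl_eq_one_sub hMm] at hc
  have : 1 - (L : ℝ) * δ ≤ 1 - (μ.prod ν).real M := by linarith
  exact this.trans hc
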